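/- arXiv:1010.5628 — 2 statements merged into one kernel-verified Lean document; each statement's English description precedes it below -/
import Mathlib

section
/- Let q ≥ 3 be an integer and let ν ≠ μ be two partitions of n such that ν strictly dominates μ in the dominance order (that is, for every k, the sum of the k largest parts of ν is at least the sum of the k largest parts of μ). Then D_ν(q) < D_μ(q). -/
open scoped Classical

/-- The hook length of a cell `c` in a Young diagram `Y`: the number of cells `(i',j')` of `Y`
with `i' ≥ i`, `j' ≥ j` and `i' = i` or `j' = j`, where `c = (i,j)` (0-indexed). -/
def hookLength (Y : YoungDiagram) (c : ℕ × ℕ) : ℕ :=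
  (Y.cells.filter fun d => c.1 ≤ d.1 ∧ c.2 ≤ d.2 ∧ (d.1 = c.1 ∨ d.2 = c.2)).card

/-- The statistic `a(λ) = ∑ᵢ (i-1)·aᵢ` of a partition (rows of the diagram are 0-indexed,
so this is the sum of the row indices of all cells). -/
def aStat (Y : YoungDiagram) : ℕ := ∑ c ∈ Y.cells, c.1

/-- The degree `D_λ(q)` of the unipotent character of `GL_n(q)` indexed by the partition `λ`
(quantized hook formula). -/
noncomputable def Dq (Y : YoungDiagram) (q : ℝ) : ℝ :=
  q ^ aStat Y * (∏ i ∈ Finset.range Y.card, (q ^ (i + 1) - 1)) /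
    ∏ c ∈ Y.cells, (q ^ hookLength Y c - 1)

/-- The degree `D⁻_λ(q)` of the unipotent character of `GU_n(q)` indexed by the partition `λ`,
obtained from the quantized hook formula by replacing `q` with `-q` and adjusting the sign. -/
noncomputable def Dqminus (Y : YoungDiagram) (q : ℝ) : ℝ :=
  |(-q) ^ aStat Y * (∏ i ∈ Finset.range Y.card, ((-q) ^ (i + 1) - 1)) /
    ∏ c ∈ Y.cells, ((-q) ^ hookLength Y c - 1)|

/-- `q^x - 1`. -/
noncomputable def uu (q : ℝ) (x : ℕ) : ℝ := q ^ x - 1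

/-- absolute difference. -/
def dd (a b : ℕ) : ℕ := (a - b) + (b - a)

lemma uu_pos {q : ℝ} (hq : 3 ≤ q) {x : ℕ} (hx : 1 ≤ x) : 0 < uu q x := by
  have : 1 < q ^ x := one_lt_pow₀ (by linarith) (by omega)
  unfold uu; linarith

lemma uu_conv {q : ℝ} (hq : 3 ≤ q) {a y : ℕ} (h : a ≤ y) :
    uu q a * uu q (y + 1) ≤ uu q (a + 1) * uu q y := by
  have : q ^ a ≤ q ^ y := pow_le_pow_right₀ (by linarith) h
  unfold uu
  rw [pow_succ, pow_succ]
  nlinarith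

/-- product over pairs. -/
noncomputable def PP (g : ℕ → ℕ → ℝ) (S : Finset ℕ) : ℝ :=
  ∏ k ∈ S, ∏ l ∈ S with k < l, g k l

lemma PP_insert (g : ℕ → ℕ → ℝ) (hg : ∀ k l, g k l = g l k) (S : Finset ℕ) (i : ℕ) (hi : i ∉ S) :
    PP g (insert i S) = PP g S * ∏ k ∈ S, g k i := by
  unfold PP
  rw [Finset.prod_insert hi]
  have h1 : ∀ k ∈ S, ∏ l ∈ insert i S with k < l, g k l
      = (if k < i then g k i else 1) * ∏ l ∈ S with k < l, g k l := by
    intro k hk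
    rw [Finset.filter_insert]
    split_ifs with h
    · rw [Finset.prod_insert (by simp [hi])]
    · simp
  rw [Finset.prod_congr rfl h1, Finset.prod_mul_distrib]
  have h2 : ∏ l ∈ insert i S with i < l, g i l = ∏ k ∈ S, (if i < k then g k i else 1) := by
    rw [Finset.filter_insert, if_neg (lt_irrefl i), Finset.prod_filter]
    exact Finset.prod_congr rfl fun k _ => by rw [hg]
  rw [h2, ← mul_assoc, ← Finset.prod_mul_distrib, mul_comm]
  congr 1
  refine Finset.prod_congr rfl fun k hk => ?_
  have : k ≠ i := fun h => hi (h ▸ hk)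
  rcases lt_or_gt_of_ne this with h | h
  · simp [h, not_lt.2 h.le]
  · simp [h, not_lt.2 h.le]

lemma PP_pos (g : ℕ → ℕ → ℝ) (S : Finset ℕ) (h : ∀ k ∈ S, ∀ l ∈ S, k < l → 0 < g k l) :
    0 < PP g S := by
  unfold PP
  refine Finset.prod_pos fun k hk => Finset.prod_pos fun l hl => ?_
  rw [Finset.mem_filter] at hl
  exact h k hk l hl.1 hl.2

/-- q-factorial. -/
noncomputable def WW (q : ℝ) (b : ℕ) : ℝ := ∏ t ∈ Finset.range b, uu q (t + 1)

lemma WW_pos {q : ℝ} (hq : 3 ≤ q) (b : ℕ) : 0 < WW q b :=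
  Finset.prod_pos fun t _ => uu_pos hq (by omega)

lemma WW_succ (q : ℝ) (b : ℕ) : WW q (b + 1) = WW q b * uu q (b + 1) :=
  Finset.prod_range_succ _ _

lemma tele {q : ℝ} (hq : 3 ≤ q) (i e : ℕ) :
    ∏ k ∈ Finset.Ioo i (i + e + 1), (uu q (k - i + 1) / uu q (k - i)) = uu q (e + 1) / uu q 1 := by
  induction e with
  | zero =>
    have : Finset.Ioo i (i + 0 + 1) = ∅ := by
      ext x; simp only [Finset.mem_Ioo, Finset.notMem_empty, iff_false]; omega
    rw [this, Finset.prod_empty, zero_add, div_self (uu_pos hq (le_refl 1)).ne']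
  | succ e ih =>
    have : Finset.Ioo i (i + (e + 1) + 1) = insert (i + e + 1) (Finset.Ioo i (i + e + 1)) := by
      ext x; simp; omega
    rw [this, Finset.prod_insert (by simp), ih]
    have h1 := (uu_pos hq (show 1 ≤ e + 1 by omega)).ne'
    have h2 := (uu_pos hq (show 1 ≤ 1 by omega)).ne'
    rw [show i + e + 1 - i = e + 1 by omega]
    field_simp

lemma tele2 {q : ℝ} (hq : 3 ≤ q) (i e : ℕ) :
    ∏ k ∈ Finset.Ioo i (i + e + 1), (uu q (i + e + 1 - k + 1) / uu q (i + e + 1 - k))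
      = uu q (e + 1) / uu q 1 := by
  rw [← tele hq i e]
  refine Finset.prod_bij' (fun k _ => i + (i + e + 1) - k) (fun k _ => i + (i + e + 1) - k)
    ?_ ?_ ?_ ?_ ?_
  · intro a ha; simp at *; omega
  · intro a ha; simp at *; omega
  · intro a ha; simp at *; omega
  · intro a ha; simp at *; omega
  · intro a ha
    simp at ha
    rw [show i + (i + e + 1) - a - i = i + e + 1 - a by omega]

/-- numeric end inequality -/
lemma final_ineq {q : ℝ} (hq : 3 ≤ q) (d D b : ℕ) (hd : 1 ≤ d) (hD : d ≤ D) (hb : 1 ≤ b) :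
    uu q (D + 2) * (uu q d / uu q 1 * (uu q d / uu q 1)) * uu q b
      < q ^ d * uu q D * uu q (b + D + 1) := by
  have h1 : uu q b * q ^ (D + 1) ≤ uu q (b + D + 1) := by
    have : 1 ≤ q ^ (D + 1) := one_le_pow₀ (by linarith)
    unfold uu
    rw [add_assoc, pow_add q b (D + 1)]; nlinarith
  have p1 := uu_pos hq (le_refl 1)
  have pd := uu_pos hq hd
  have pD := uu_pos hq (hd.trans hD)
  have pb := uu_pos hq hb
  have pD2 := uu_pos hq (show 1 ≤ D + 2 by omega)
  have hdD : uu q d ≤ uu q D := by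
    have := pow_le_pow_right₀ (show 1 ≤ q by linarith) hD
    unfold uu; linarith
  have h2 : uu q (D + 2) * uu q d < q ^ (D + 2) * q ^ d := by
    have e1 : uu q (D + 2) < q ^ (D + 2) := by unfold uu; linarith
    have e2 : uu q d < q ^ d := by unfold uu; linarith
    exact mul_lt_mul'' e1 e2 pD2.le pd.le
  have h3 : q ≤ uu q 1 * uu q 1 := by unfold uu; nlinarith
  have hqd : 0 < q ^ (D + 1) * q ^ d := by positivity
  have h4 : uu q (D + 2) * uu q d < q ^ (D + 1) * q ^ d * (uu q 1 * uu q 1) := by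
    refine h2.trans_le ?_
    rw [pow_succ q (D + 1)]
    nlinarith
  have h5 : uu q (D + 2) * (uu q d / uu q 1 * (uu q d / uu q 1))
      < q ^ (D + 1) * q ^ d * uu q D := by
    have : uu q (D + 2) * (uu q d / uu q 1 * (uu q d / uu q 1))
      = (uu q (D + 2) * uu q d) * uu q d / (uu q 1 * uu q 1) := by field_simp
    rw [this, div_lt_iff₀ (by positivity)]
    calc _ ≤ (uu q (D + 2) * uu q d) * uu q D := by gcongr
      _ < (q ^ (D + 1) * q ^ d * (uu q 1 * uu q 1)) * uu q D := by gcongr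
      _ = _ := by ring
  calc _ < q ^ (D + 1) * q ^ d * uu q D * uu q b := by gcongr
    _ = q ^ d * uu q D * (uu q b * q ^ (D + 1)) := by ring
    _ ≤ _ := by gcongr

lemma dd_comm (a b : ℕ) : dd a b = dd b a := by unfold dd; omega

/-- the pair weights -/
noncomputable def gg (q : ℝ) (β : ℕ → ℕ) (k l : ℕ) : ℝ := uu q (dd (β k) (β l))

lemma gg_comm (q : ℝ) (β : ℕ → ℕ) (k l : ℕ) : gg q β k l = gg q β l k := by
  unfold gg; rw [dd_comm]

/-- the correction factor -/
noncomputable def cc (q : ℝ) (i j k : ℕ) : ℝ :=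
  if k ∈ Finset.Ioo i j then uu q (k - i + 1) / uu q (k - i) * (uu q (j - k + 1) / uu q (j - k))
  else 1

lemma pointwise {q : ℝ} (hq : 3 ≤ q) (m i j k : ℕ) (β β' : ℕ → ℕ) (hij : i < j) (hj : j < m)
    (hk : k < m) (hki : k ≠ i) (hkj : k ≠ j)
    (hβ : ∀ k l, k < l → l < m → β l + (l - k) ≤ β k)
    (hβ' : ∀ k l, k < l → l < m → β' l + (l - k) ≤ β' k)
    (hi' : β' i = β i + 1) (hj' : β' j + 1 = β j) (hk' : β' k = β k) :
    gg q β' k j * gg q β' k i ≤ gg q β k j * gg q β k i * cc q i j k := by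
  have hD := hβ i j hij hj
  unfold gg cc
  rcases lt_or_gt_of_ne hki with h | h
  · rw [if_neg (by simp; omega), mul_one, hk', hi']
    have h1 := hβ' k i h (by omega)
    have e1 : dd (β k) (β' j) = dd (β k) (β j) + 1 := by unfold dd; omega
    have e2 : dd (β k) (β i) = dd (β k) (β i + 1) + 1 := by unfold dd; omega
    rw [e1, e2]
    have := uu_conv hq (show dd (β k) (β i + 1) ≤ dd (β k) (β j) by unfold dd; omega)
    linarith
  · rcases lt_or_gt_of_ne hkj with h' | h'
    · rw [if_pos (by simp; omega), hk', hi']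
      have h1 := hβ i k h (by omega)
      have h2 := hβ k j h' (by omega)
      have e1 : dd (β k) (β' j) = dd (β k) (β j) + 1 := by unfold dd; omega
      have e2 : dd (β k) (β i + 1) = dd (β k) (β i) + 1 := by unfold dd; omega
      have q1 : k - i ≤ dd (β k) (β i) := by unfold dd; omega
      have q2 : j - k ≤ dd (β k) (β j) := by unfold dd; omega
      have r1 := uu_conv hq q1
      have r2 := uu_conv hq q2
      have p1 := uu_pos hq (show 1 ≤ k - i by omega)
      have p2 := uu_pos hq (show 1 ≤ j - k by omega)
      have p3 := uu_pos hq (show 1 ≤ dd (β k) (β i) + 1 by omega)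
      have p4 := uu_pos hq (show 1 ≤ dd (β k) (β j) by omega)
      have p5 := uu_pos hq (show 1 ≤ j - k + 1 by omega)
      rw [e1, e2]
      have s1 : uu q (dd (β k) (β i) + 1) ≤ uu q (k - i + 1) / uu q (k - i) * uu q (dd (β k) (β i)) := by
        rw [div_mul_eq_mul_div, le_div_iff₀ p1]; linarith
      have s2 : uu q (dd (β k) (β j) + 1) ≤ uu q (j - k + 1) / uu q (j - k) * uu q (dd (β k) (β j)) := by
        rw [div_mul_eq_mul_div, le_div_iff₀ p2]; linarith
      calc _ ≤ _ := mul_le_mul s2 s1 p3.le (by positivity)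
        _ = _ := by ring
    · rw [if_neg (by simp; omega), mul_one, hk', hi']
      have h1 := hβ' j k h' (by omega)
      have e1 : dd (β k) (β j) = dd (β k) (β' j) + 1 := by unfold dd; omega
      have e2 : dd (β k) (β i + 1) = dd (β k) (β i) + 1 := by unfold dd; omega
      rw [e1, e2]
      exact uu_conv hq (show dd (β k) (β' j) ≤ dd (β k) (β i) by unfold dd; omega)

/-- the core degree quantity -/
noncomputable def FF (q : ℝ) (m : ℕ) (A : ℕ) (β : ℕ → ℕ) : ℝ :=
  q ^ A * PP (gg q β) (Finset.range m) / ∏ k ∈ Finset.range m, WW q (β k)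

lemma move {q : ℝ} (hq : 3 ≤ q) (m i j A A' : ℕ) (β β' : ℕ → ℕ) (hij : i < j) (hj : j < m)
    (hβ : ∀ k l, k < l → l < m → β l + (l - k) ≤ β k)
    (hβ' : ∀ k l, k < l → l < m → β' l + (l - k) ≤ β' k)
    (hi' : β' i = β i + 1) (hj' : β' j + 1 = β j)
    (hk' : ∀ k, k ≠ i → k ≠ j → β' k = β k) (hA : A' + (j - i) = A) :
    FF q m A' β' < FF q m A β := by
  obtain ⟨T, hT⟩ : ∃ T, T = ((Finset.range m).erase i).erase j := ⟨_, rfl⟩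
  have hTm : ∀ k, k ∈ T ↔ k < m ∧ k ≠ i ∧ k ≠ j := by
    intro k; rw [hT]; simp; tauto
  have hjT : j ∉ T := by rw [hTm]; tauto
  have hiT : i ∉ insert j T := by rw [Finset.mem_insert, hTm]; omega
  have hS : Finset.range m = insert i (insert j T) := by
    ext k; simp only [Finset.mem_insert, hTm, Finset.mem_range]; omega
  have key : ∀ γ : ℕ → ℕ, PP (gg q γ) (Finset.range m)
      = PP (gg q γ) T * (gg q γ j i * ∏ k ∈ T, (gg q γ k j * gg q γ k i)) := by
    intro γ
    rw [hS, PP_insert _ (gg_comm q γ) _ _ hiT, PP_insert _ (gg_comm q γ) _ _ hjT,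
      Finset.prod_insert hjT, Finset.prod_mul_distrib]
    ring
  have keyW : ∀ γ : ℕ → ℕ, ∏ k ∈ Finset.range m, WW q (γ k)
      = WW q (γ i) * (WW q (γ j) * ∏ k ∈ T, WW q (γ k)) := by
    intro γ
    rw [hS, Finset.prod_insert hiT, Finset.prod_insert hjT]
  have hPT : PP (gg q β') T = PP (gg q β) T := by
    unfold PP
    refine Finset.prod_congr rfl fun k hk => Finset.prod_congr rfl fun l hl => ?_
    have h1 := (hTm k).1 hk
    have h2 := (hTm l).1 (Finset.mem_filter.1 hl).1
    unfold gg
    rw [hk' k h1.2.1 h1.2.2, hk' l h2.2.1 h2.2.2]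
  have hWT : ∏ k ∈ T, WW q (β' k) = ∏ k ∈ T, WW q (β k) := by
    refine Finset.prod_congr rfl fun k hk => ?_
    have h1 := (hTm k).1 hk
    rw [hk' k h1.2.1 h1.2.2]
  have ggpos : ∀ k l, k < m → l < m → k ≠ l → 0 < gg q β k l := by
    intro k l hk hl hkl
    refine uu_pos hq ?_
    rcases lt_or_gt_of_ne hkl with h | h
    · have := hβ k l h hl; unfold dd; omega
    · have := hβ l k h hk; unfold dd; omega
  have hPpos : 0 < PP (gg q β) T := by
    refine PP_pos _ _ fun k hk l hl hkl => ?_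
    exact ggpos k l ((hTm k).1 hk).1 ((hTm l).1 hl).1 hkl.ne
  have hWpos : 0 < ∏ k ∈ T, WW q (β k) := Finset.prod_pos fun k _ => WW_pos hq _
  have hprod : ∏ k ∈ T, (gg q β' k j * gg q β' k i)
      ≤ (∏ k ∈ T, (gg q β k j * gg q β k i)) * ∏ k ∈ T, cc q i j k := by
    rw [← Finset.prod_mul_distrib]
    refine Finset.prod_le_prod ?_ ?_
    · intro k hk
      have h1 := (hTm k).1 hk
      have nn : ∀ x, 0 ≤ uu q x := by
        intro x
        have : 1 ≤ q ^ x := one_le_pow₀ (by linarith)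
        unfold uu; linarith
      exact mul_nonneg (nn _) (nn _)
    · intro k hk
      have h1 := (hTm k).1 hk
      exact pointwise hq m i j k β β' hij hj h1.1 h1.2.1 h1.2.2 hβ hβ' hi' hj'
        (hk' k h1.2.1 h1.2.2)
  have hcc : ∏ k ∈ T, cc q i j k = uu q (j - i) / uu q 1 * (uu q (j - i) / uu q 1) := by
    unfold cc
    rw [← Finset.prod_filter]
    have : T.filter (fun k => k ∈ Finset.Ioo i j) = Finset.Ioo i j := by
      ext k; simp only [Finset.mem_filter, hTm, Finset.mem_Ioo]; omega
    rw [this, Finset.prod_mul_distrib]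
    obtain ⟨e, rfl⟩ : ∃ e, j = i + e + 1 := ⟨j - i - 1, by omega⟩
    rw [tele hq, tele2 hq, show i + e + 1 - i = e + 1 by omega]
  have hQpos : 0 < ∏ k ∈ T, (gg q β k j * gg q β k i) := by
    refine Finset.prod_pos fun k hk => ?_
    have h1 := (hTm k).1 hk
    exact mul_pos (ggpos _ _ h1.1 hj h1.2.2) (ggpos _ _ h1.1 (by omega) h1.2.1)
  have hD := hβ i j hij hj
  obtain ⟨D, hDe⟩ : ∃ D, β i = β j + D := ⟨β i - β j, by omega⟩
  have hfin := final_ineq hq (j - i) D (β j) (by omega) (by omega) (by omega)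
  have e1 : gg q β j i = uu q D := by unfold gg dd; congr 1; omega
  have e2 : gg q β' j i = uu q (D + 2) := by unfold gg dd; congr 1; omega
  have w1 : WW q (β' i) = WW q (β i) * uu q (β j + D + 1) := by
    rw [hi', WW_succ, hDe]
  have w2 : WW q (β j) = WW q (β' j) * uu q (β j) := by
    rw [← hj', WW_succ]
  unfold FF
  rw [key β, key β', keyW β, keyW β', hPT, hWT, e1, e2, w1, w2, ← hA, pow_add]
  rw [hcc] at hprod
  generalize ∏ k ∈ T, (gg q β k j * gg q β k i) = Q at *
  generalize ∏ k ∈ T, (gg q β' k j * gg q β' k i) = Q' at *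
  generalize ∏ k ∈ T, WW q (β k) = C at *
  generalize PP (gg q β) T = P at *
  have pa := WW_pos hq (β i)
  have pb := WW_pos hq (β' j)
  have pD2 := uu_pos hq (show 1 ≤ D + 2 by omega)
  have pbj := uu_pos hq (show 1 ≤ β j by omega)
  have pbD := uu_pos hq (show 1 ≤ β j + D + 1 by omega)
  have pq : 0 < q ^ A' := by positivity
  rw [div_lt_div_iff₀ (by positivity) (by positivity)]
  generalize WW q (β i) = X at *
  generalize WW q (β' j) = Y at *
  have main : uu q (D + 2) * Q' * uu q (β j) < q ^ (j - i) * uu q D * uu q (β j + D + 1) * Q := by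
    calc _ ≤ uu q (D + 2) * (Q * (uu q (j - i) / uu q 1 * (uu q (j - i) / uu q 1))) * uu q (β j) := by
          gcongr
      _ = uu q (D + 2) * (uu q (j - i) / uu q 1 * (uu q (j - i) / uu q 1)) * uu q (β j) * Q := by ring
      _ < _ := by gcongr
  have z : 0 < q ^ A' * P * X * Y * C := by positivity
  have := mul_lt_mul_of_pos_left main z
  calc _ = q ^ A' * P * X * Y * C * (uu q (D + 2) * Q' * uu q (β j)) := by ring
    _ < _ := this
    _ = _ := by ring

/-- degree as function of row lengths -/
noncomputable def GG (q : ℝ) (m : ℕ) (f : ℕ → ℕ) : ℝ :=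
  FF q m (∑ k ∈ Finset.range m, k * f k) (fun k => f k + (m - 1 - k))

/-- the modified row lengths -/
def mv (f : ℕ → ℕ) (i j : ℕ) : ℕ → ℕ :=
  fun k => if k = i then f i + 1 else if k = j then f j - 1 else f k

lemma mv_sum (f w : ℕ → ℕ) (i j : ℕ) (hij : i < j) (hj : 1 ≤ f j) (k : ℕ) :
    ∑ t ∈ Finset.range k, w t * mv f i j t + (if j < k then w j else 0)
      = ∑ t ∈ Finset.range k, w t * f t + (if i < k then w i else 0) := by
  induction k with
  | zero => simp
  | succ k ih =>
    rw [Finset.sum_range_succ, Finset.sum_range_succ]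
    unfold mv at *
    rcases eq_or_ne k i with rfl | h1
    · simp only [if_true, lt_irrefl, if_false, not_lt.2 hij.le, not_lt.2 (Nat.succ_le_of_lt hij),
        Nat.lt_succ_self] at *
      rw [mul_add]; linarith
    · rcases eq_or_ne k j with rfl | h2
      · obtain ⟨x, hx⟩ : ∃ x, f k = x + 1 := ⟨f k - 1, by omega⟩
        simp only [if_neg h1, if_true, lt_irrefl, if_false, hij, Nat.lt_succ_self,
          Nat.lt_succ_of_lt hij, hx, Nat.add_sub_cancel] at ih ⊢
        rw [mul_add]; linarith
      · have a1 : (i < k + 1) = (i < k) := by apply propext; omega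
        have a2 : (j < k + 1) = (j < k) := by apply propext; omega
        simp only [if_neg h1, if_neg h2, a1, a2]
        linarith

lemma chain {q : ℝ} (hq : 3 ≤ q) (m : ℕ) (g : ℕ → ℕ) (hg : Antitone g) (hg0 : ∀ k, m ≤ k → g k = 0) :
    ∀ (s : ℕ) (f : ℕ → ℕ), Antitone f → (∀ k, m ≤ k → f k = 0) →
    (∀ k, ∑ t ∈ Finset.range k, f t ≤ ∑ t ∈ Finset.range k, g t) →
    (∑ t ∈ Finset.range m, f t = ∑ t ∈ Finset.range m, g t) → f ≠ g →
    (∑ k ∈ Finset.range m, ∑ t ∈ Finset.range k, g t) = s + 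
      (∑ k ∈ Finset.range m, ∑ t ∈ Finset.range k, f t) →
    GG q m g < GG q m f := by
  intro s
  induction s using Nat.strong_induction_on with
  | _ s ih =>
  intro f hf hf0 hdom htot hne hs
  have ex : ∃ i, f i ≠ g i := by
    by_contra h; push Not at h; exact hne (funext h)
  obtain ⟨i, hi, hmin⟩ : ∃ i, f i ≠ g i ∧ ∀ k < i, f k = g k :=
    ⟨Nat.find ex, Nat.find_spec ex, fun k hk => by simpa using Nat.find_min ex hk⟩
  have hSi : ∑ t ∈ Finset.range i, f t = ∑ t ∈ Finset.range i, g t :=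
    Finset.sum_congr rfl fun k hk => hmin k (Finset.mem_range.1 hk)
  have hi1 : f i < g i := by
    have := hdom (i + 1)
    rw [Finset.sum_range_succ, Finset.sum_range_succ] at this
    omega
  have him : i < m := by
    by_contra h; have := hg0 i (by omega); omega
  have ex2 : ∃ j, i < j ∧ ∑ t ∈ Finset.range (j + 1), f t = ∑ t ∈ Finset.range (j + 1), g t := by
    refine ⟨m, him, ?_⟩
    rw [Finset.sum_range_succ, Finset.sum_range_succ, htot, hf0 m le_rfl, hg0 m le_rfl]
  obtain ⟨j, ⟨hij, hSj⟩, hjmin⟩ : ∃ j, (i < j ∧ ∑ t ∈ Finset.range (j + 1), f t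
      = ∑ t ∈ Finset.range (j + 1), g t) ∧ ∀ k < j, ¬ (i < k ∧ ∑ t ∈ Finset.range (k + 1), f t
      = ∑ t ∈ Finset.range (k + 1), g t) :=
    ⟨Nat.find ex2, Nat.find_spec ex2, fun k hk => Nat.find_min ex2 hk⟩
  have hstrict : ∀ k, i < k → k ≤ j →
      ∑ t ∈ Finset.range k, f t < ∑ t ∈ Finset.range k, g t := by
    intro k h1 h2
    refine lt_of_le_of_ne (hdom k) fun h => ?_
    rcases eq_or_ne k (i + 1) with rfl | h3
    · rw [Finset.sum_range_succ, Finset.sum_range_succ] at h; omega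
    · obtain ⟨k, rfl⟩ : ∃ l, k = l + 1 := ⟨k - 1, by omega⟩
      exact hjmin k (by omega) ⟨by omega, h⟩
  have hj1 : g j < f j := by
    have := hstrict j hij le_rfl
    rw [Finset.sum_range_succ, Finset.sum_range_succ] at hSj
    omega
  have hj2 : f (j + 1) ≤ g (j + 1) := by
    have := hdom (j + 1 + 1)
    rw [Finset.sum_range_succ, Finset.sum_range_succ _ (j + 1)] at this
    omega
  have hj3 : g (j + 1) ≤ g j := hg (by omega)
  have hjm : j < m := by
    by_contra h; have := hf0 j (by omega); omega
  have hfj : 1 ≤ f j := by omega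
  -- the new partition
  have hmi : mv f i j i = f i + 1 := by simp [mv]
  have hmj : mv f i j j = f j - 1 := by simp [mv, hij.ne']
  have hmk : ∀ k, k ≠ i → k ≠ j → mv f i j k = f k := by
    intro k h1 h2; simp [mv, h1, h2]
  have hanti : Antitone (mv f i j) := by
    refine antitone_nat_of_succ_le fun k => ?_
    have h0 := hf (show k ≤ k + 1 by omega)
    rcases eq_or_ne k i with rfl | h1
    · rw [hmi]
      rcases eq_or_ne (k + 1) j with h2 | h2
      · rw [h2, hmj, ← h2]; omega
      · rw [hmk _ (by omega) h2]; omega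
    · rcases eq_or_ne k j with rfl | h2
      · rw [hmj, hmk _ (by omega) (by omega)]; omega
      · rw [hmk k h1 h2]
        rcases eq_or_ne (k + 1) i with h3 | h3
        · rw [h3, hmi]
          have a := hmin k (by omega)
          have b := hg (show k ≤ i by omega)
          omega
        · rcases eq_or_ne (k + 1) j with h4 | h4
          · rw [h4, hmj, ← h4]; omega
          · rw [hmk _ h3 h4]; exact h0
  have hsum : ∀ k, ∑ t ∈ Finset.range k, mv f i j t + (if j < k then 1 else 0)
      = ∑ t ∈ Finset.range k, f t + (if i < k then 1 else 0) := by
    intro k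
    simpa using mv_sum f (fun _ => 1) i j hij hfj k
  have hstep : GG q m (mv f i j) < GG q m f := by
    unfold GG
    have strict : ∀ f : ℕ → ℕ, Antitone f → ∀ k l, k < l → l < m →
        f l + (m - 1 - l) + (l - k) ≤ f k + (m - 1 - k) := by
      intro f hf k l h1 h2
      have := hf h1.le
      omega
    refine move hq m i j _ _ _ _ hij hjm (strict f hf) (strict _ hanti) ?_ ?_ ?_ ?_
    · simp only [hmi]; omega
    · simp only [hmj]; omega
    · intro k h1 h2; simp only [hmk k h1 h2]
    · have := mv_sum f (fun k => k) i j hij hfj m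
      simp only [hjm, him, if_true] at this
      omega
  by_cases heq : mv f i j = g
  · rw [heq] at hstep; exact hstep
  · refine lt_trans ?_ hstep
    have hle : ∀ k, ∑ t ∈ Finset.range k, f t ≤ ∑ t ∈ Finset.range k, mv f i j t := by
      intro k
      have := hsum k
      split_ifs at this <;> omega
    have hlt : (∑ k ∈ Finset.range m, ∑ t ∈ Finset.range k, f t)
        < ∑ k ∈ Finset.range m, ∑ t ∈ Finset.range k, mv f i j t := by
      refine Finset.sum_lt_sum (fun k _ => hle k) ⟨j, Finset.mem_range.2 hjm, ?_⟩
      have := hsum j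
      rw [if_neg (lt_irrefl j), if_pos hij] at this
      omega
    have hdom' : ∀ k, ∑ t ∈ Finset.range k, mv f i j t ≤ ∑ t ∈ Finset.range k, g t := by
      intro k
      have h1 := hsum k
      have h2 := hdom k
      by_cases h3 : i < k
      · by_cases h4 : j < k
        · rw [if_pos h3, if_pos h4] at h1; omega
        · rw [if_pos h3, if_neg h4] at h1
          have := hstrict k h3 (by omega)
          omega
      · rw [if_neg h3, if_neg (by omega)] at h1; omega
    have hle2 : (∑ k ∈ Finset.range m, ∑ t ∈ Finset.range k, mv f i j t)
        ≤ ∑ k ∈ Finset.range m, ∑ t ∈ Finset.range k, g t :=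
      Finset.sum_le_sum fun k _ => hdom' k
    refine ih ((∑ k ∈ Finset.range m, ∑ t ∈ Finset.range k, g t)
      - ∑ k ∈ Finset.range m, ∑ t ∈ Finset.range k, mv f i j t) (by omega) (mv f i j) hanti
      ?_ hdom' ?_ heq (by omega)
    · intro k hk
      rw [hmk k (by omega) (by omega)]; exact hf0 k hk
    · have := hsum m
      rw [if_pos him, if_pos hjm] at this
      omega

/-! ### Hook lengths -/

lemma hook_eq (Y : YoungDiagram) (i j : ℕ) (h : (i, j) ∈ Y) :
    hookLength Y (i, j) + (i + j + 1) = Y.rowLen i + Y.colLen j := by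
  have hr := YoungDiagram.mem_iff_lt_rowLen.1 h
  have hc := YoungDiagram.mem_iff_lt_colLen.1 h
  have : (Y.cells.filter fun d => i ≤ d.1 ∧ j ≤ d.2 ∧ (d.1 = i ∨ d.2 = j))
      = ((Finset.Ico j (Y.rowLen i)).image fun b => (i, b))
        ∪ ((Finset.Ioo i (Y.colLen j)).image fun a => (a, j)) := by
    ext ⟨a, b⟩
    simp only [Finset.mem_filter, Finset.mem_union, Finset.mem_image, Finset.mem_Ico,
      Finset.mem_Ioo, Prod.mk.injEq, YoungDiagram.mem_cells]
    constructor
    · rintro ⟨h1, h2, h3, h4⟩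
      rcases eq_or_ne a i with rfl | h5
      · exact Or.inl ⟨b, ⟨h3, YoungDiagram.mem_iff_lt_rowLen.1 h1⟩, rfl, rfl⟩
      · obtain rfl : b = j := by tauto
        exact Or.inr ⟨a, ⟨by omega, YoungDiagram.mem_iff_lt_colLen.1 h1⟩, rfl, rfl⟩
    · rintro (⟨b', ⟨h1, h2⟩, rfl, rfl⟩ | ⟨a', ⟨h1, h2⟩, rfl, rfl⟩)
      · exact ⟨YoungDiagram.mem_iff_lt_rowLen.2 h2, le_rfl, h1, Or.inl rfl⟩
      · exact ⟨YoungDiagram.mem_iff_lt_colLen.2 h2, h1.le, le_rfl, Or.inr rfl⟩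
  have hcard : hookLength Y (i, j) = (Y.rowLen i - j) + (Y.colLen j - i - 1) := by
    unfold hookLength
    simp only
    rw [this, Finset.card_union_of_disjoint, Finset.card_image_of_injective,
      Finset.card_image_of_injective]
    · simp
    · intro a b hab; simpa using hab
    · intro a b hab; simpa using hab
    · rw [Finset.disjoint_left]
      rintro ⟨a, b⟩ h1 h2
      simp only [Finset.mem_image, Finset.mem_Ico, Finset.mem_Ioo, Prod.mk.injEq] at h1 h2
      obtain ⟨_, _, rfl, _⟩ := h1
      obtain ⟨_, _, rfl, _⟩ := h2
      omega
  omega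

lemma row_prod (q : ℝ) (Y : YoungDiagram) (m i : ℕ) (hi : i < m) (hm : ∀ k, m ≤ k → Y.rowLen k = 0) :
    (∏ j ∈ Finset.range (Y.rowLen i), uu q (hookLength Y (i, j)))
      * ∏ k ∈ Finset.range m with i < k, uu q (Y.rowLen i + k - (Y.rowLen k + i))
    = WW q (Y.rowLen i + (m - 1 - i)) := by
  have hook : ∀ j < Y.rowLen i, hookLength Y (i, j) + (i + j + 1) = Y.rowLen i + Y.colLen j :=
    fun j hj => hook_eq Y i j (YoungDiagram.mem_iff_lt_rowLen.2 hj)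
  have colm : ∀ j, Y.colLen j ≤ m := by
    intro j
    by_contra h
    push Not at h
    have := YoungDiagram.mem_iff_lt_rowLen.1 (YoungDiagram.mem_iff_lt_colLen.2 h)
    have := hm m le_rfl
    omega
  have icol : ∀ j < Y.rowLen i, i < Y.colLen j := fun j hj =>
    YoungDiagram.mem_iff_lt_colLen.1 (YoungDiagram.mem_iff_lt_rowLen.2 hj)
  have dual : ∀ k j, j < Y.rowLen k ↔ k < Y.colLen j := fun k j => by
    rw [← YoungDiagram.mem_iff_lt_rowLen, ← YoungDiagram.mem_iff_lt_colLen]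
  have injA : Set.InjOn (fun j => hookLength Y (i, j)) (Finset.range (Y.rowLen i) : Set ℕ) := by
    intro a ha b hb hab
    simp only [Finset.coe_range, Set.mem_Iio] at ha hb hab
    have h1 := hook a ha
    have h2 := hook b hb
    rcases lt_trichotomy a b with h | h | h
    · have := Y.colLen_anti a b h.le; omega
    · exact h
    · have := Y.colLen_anti b a h.le; omega
  have injB : Set.InjOn (fun k => Y.rowLen i + k - (Y.rowLen k + i))
      ((Finset.range m).filter (i < ·) : Set ℕ) := by
    intro a ha b hb hab
    simp only [Finset.coe_filter, Finset.mem_range, Set.mem_ofPred_eq] at ha hb hab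
    have h1 := Y.rowLen_anti i a ha.2.le
    have h2 := Y.rowLen_anti i b hb.2.le
    rcases lt_trichotomy a b with h | h | h
    · have := Y.rowLen_anti a b h.le; omega
    · exact h
    · have := Y.rowLen_anti b a h.le; omega
  have disj : Disjoint ((Finset.range (Y.rowLen i)).image fun j => hookLength Y (i, j))
      (((Finset.range m).filter (i < ·)).image fun k => Y.rowLen i + k - (Y.rowLen k + i)) := by
    rw [Finset.disjoint_left]
    intro x h1 h2
    simp only [Finset.mem_image, Finset.mem_range, Finset.mem_filter] at h1 h2
    obtain ⟨j, hj, rfl⟩ := h1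
    obtain ⟨k, ⟨hk, hik⟩, he⟩ := h2
    have h1 := hook j hj
    have h2 := Y.rowLen_anti i k hik.le
    have h3 := dual k j
    by_cases h4 : j < Y.rowLen k
    · have := h3.1 h4; omega
    · have : ¬ k < Y.colLen j := fun h => h4 (h3.2 h)
      omega
  have hun : ((Finset.range (Y.rowLen i)).image fun j => hookLength Y (i, j)) ∪
      (((Finset.range m).filter (i < ·)).image fun k => Y.rowLen i + k - (Y.rowLen k + i))
      = (Finset.range (Y.rowLen i + (m - 1 - i))).image (· + 1) := by
    refine Finset.eq_of_subset_of_card_le ?_ ?_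
    · intro x hx
      simp only [Finset.mem_union, Finset.mem_image, Finset.mem_range, Finset.mem_filter] at hx ⊢
      refine ⟨x - 1, ?_⟩
      rcases hx with ⟨j, hj, rfl⟩ | ⟨k, ⟨hk, hik⟩, rfl⟩
      · have h1 := hook j hj
        have := icol j hj
        have := colm j
        omega
      · have h2 := Y.rowLen_anti i k hik.le
        omega
    · rw [Finset.card_union_of_disjoint disj, Finset.card_image_of_injOn injA,
        Finset.card_image_of_injOn injB, Finset.card_image_of_injective _ (add_left_injective 1)]
      have : (Finset.range m).filter (i < ·) = Finset.Ioo i m := by ext; simp; omega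
      rw [this]
      simp
      omega
  rw [← Finset.prod_image (f := fun x => uu q x) injA,
    ← Finset.prod_image (f := fun x => uu q x) injB, ← Finset.prod_union disj, hun,
    Finset.prod_image (add_left_injective 1).injOn]
  rfl

lemma Dq_eq {q : ℝ} (hq : 3 ≤ q) (Y : YoungDiagram) (m : ℕ) (hm : ∀ k, m ≤ k → Y.rowLen k = 0) :
    Dq Y q = WW q Y.card * GG q m Y.rowLen := by
  have hcell : ∀ p : ℕ × ℕ, p ∈ Y.cells ↔ p.1 ∈ Finset.range m ∧ p.2 ∈ Finset.range (Y.rowLen p.1) := by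
    rintro ⟨a, b⟩
    rw [YoungDiagram.mem_cells, YoungDiagram.mem_iff_lt_rowLen]
    simp only [Finset.mem_range]
    constructor
    · intro h
      refine ⟨?_, h⟩
      by_contra h'
      have := hm a (by omega)
      omega
    · exact fun h => h.2
  have ha : aStat Y = ∑ k ∈ Finset.range m, k * Y.rowLen k := by
    unfold aStat
    rw [Finset.sum_finset_product Y.cells (Finset.range m) (fun k => Finset.range (Y.rowLen k)) hcell]
    refine Finset.sum_congr rfl fun k _ => ?_
    simp [mul_comm]
  have hprod : (∏ c ∈ Y.cells, (q ^ hookLength Y c - 1))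
      * PP (gg q fun k => Y.rowLen k + (m - 1 - k)) (Finset.range m)
      = ∏ k ∈ Finset.range m, WW q (Y.rowLen k + (m - 1 - k)) := by
    rw [Finset.prod_finset_product Y.cells (Finset.range m)
      (fun k => Finset.range (Y.rowLen k)) hcell]
    unfold PP
    rw [← Finset.prod_mul_distrib]
    refine Finset.prod_congr rfl fun i hi => ?_
    rw [Finset.mem_range] at hi
    rw [← row_prod q Y m i hi hm]
    congr 1
    refine Finset.prod_congr rfl fun k hk => ?_
    simp only [Finset.mem_filter, Finset.mem_range] at hk
    have := Y.rowLen_anti i k hk.2.le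
    unfold gg dd
    congr 1
    simp only
    omega
  have hWpos : 0 < ∏ k ∈ Finset.range m, WW q (Y.rowLen k + (m - 1 - k)) :=
    Finset.prod_pos fun k _ => WW_pos hq _
  have h1 : (∏ c ∈ Y.cells, (q ^ hookLength Y c - 1)) ≠ 0 := by
    intro h; rw [h, zero_mul] at hprod; exact hWpos.ne hprod
  unfold Dq GG FF
  rw [ha, ← hprod]
  have h2 : PP (gg q fun k => Y.rowLen k + (m - 1 - k)) (Finset.range m) ≠ 0 := by
    intro h; rw [h, mul_zero] at hprod; exact hWpos.ne hprod
  have h3 : ∏ i ∈ Finset.range Y.card, (q ^ (i + 1) - 1) = WW q Y.card := rfl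
  rw [h3]
  field_simp

lemma rowLen_zero (Y : YoungDiagram) (k : ℕ) (hk : Y.card ≤ k) : Y.rowLen k = 0 := by
  by_contra h
  have hmem : (k, 0) ∈ Y := YoungDiagram.mem_iff_lt_rowLen.2 (by omega)
  have h1 := YoungDiagram.mem_iff_lt_colLen.1 hmem
  have h2 : Y.colLen 0 ≤ Y.card := by
    rw [YoungDiagram.colLen_eq_card]
    exact Finset.card_le_card (Finset.filter_subset _ _)
  omega

lemma card_eq_sum (Y : YoungDiagram) (m : ℕ) (hm : ∀ k, m ≤ k → Y.rowLen k = 0) :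
    Y.card = ∑ k ∈ Finset.range m, Y.rowLen k := by
  have hcell : ∀ p : ℕ × ℕ, p ∈ Y.cells ↔ p.1 ∈ Finset.range m ∧ p.2 ∈ Finset.range (Y.rowLen p.1) := by
    rintro ⟨a, b⟩
    rw [YoungDiagram.mem_cells, YoungDiagram.mem_iff_lt_rowLen]
    simp only [Finset.mem_range]
    constructor
    · intro h
      refine ⟨?_, h⟩
      by_contra h'
      have := hm a (by omega)
      omega
    · exact fun h => h.2
  have := Finset.sum_finset_product Y.cells (Finset.range m)
    (fun k => Finset.range (Y.rowLen k)) hcell (f := fun _ => (1 : ℕ))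
  simpa using this

/-- if `q ≥ 3` and `ν ≠ μ` are partitions of `n` with `ν` dominating `μ`,
then `D_ν(q) < D_μ(q)`. -/
theorem stmt8 (n : ℕ) (q : ℤ) (hq : 3 ≤ q) (M N : YoungDiagram)
    (hM : M.card = n) (hN : N.card = n) (hne : N ≠ M)
    (hdom : ∀ k : ℕ, ∑ i ∈ Finset.range k, M.rowLen i ≤ ∑ i ∈ Finset.range k, N.rowLen i) :
    Dq N (q : ℝ) < Dq M (q : ℝ) := by
  have hq' : (3 : ℝ) ≤ (q : ℝ) := by exact_mod_cast hq
  have hM0 : ∀ k, n ≤ k → M.rowLen k = 0 := fun k hk => rowLen_zero M k (by omega)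
  have hN0 : ∀ k, n ≤ k → N.rowLen k = 0 := fun k hk => rowLen_zero N k (by omega)
  rw [Dq_eq hq' M n hM0, Dq_eq hq' N n hN0, hM, hN]
  refine mul_lt_mul_of_pos_left ?_ (WW_pos hq' n)
  have hle : (∑ k ∈ Finset.range n, ∑ t ∈ Finset.range k, M.rowLen t)
      ≤ ∑ k ∈ Finset.range n, ∑ t ∈ Finset.range k, N.rowLen t :=
    Finset.sum_le_sum fun k _ => hdom k
  refine chain hq' n N.rowLen (fun a b h => N.rowLen_anti a b h) hN0
    ((∑ k ∈ Finset.range n, ∑ t ∈ Finset.range k, N.rowLen t)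
      - ∑ k ∈ Finset.range n, ∑ t ∈ Finset.range k, M.rowLen t) M.rowLen
    (fun a b h => M.rowLen_anti a b h) hM0 hdom ?_ ?_ (by omega)
  · rw [← card_eq_sum M n hM0, ← card_eq_sum N n hN0, hM, hN]
  · intro h
    apply hne
    apply YoungDiagram.ext
    ext ⟨a, b⟩
    rw [YoungDiagram.mem_cells, YoungDiagram.mem_cells, YoungDiagram.mem_iff_lt_rowLen,
      YoungDiagram.mem_iff_lt_rowLen, h]
end

section
/- Let q ≥ 2 be a real number and n ≥ 1 an integer. Then 1 < Π_{i=1}^n (1 − (−1/q)^i) ≤ 3/2. -/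
theorem stmt17_aux (x : ℝ) (h0 : 0 < x) (h1 : x ≤ 1 / 2) (m : ℕ) :
    (1 < ∏ i ∈ Finset.range (2 * m + 1), (1 - (-x) ^ (i + 1)) ∧
      ∏ i ∈ Finset.range (2 * m + 1), (1 - (-x) ^ (i + 1)) ≤ 3 / 2) ∧
    (1 < ∏ i ∈ Finset.range (2 * m + 2), (1 - (-x) ^ (i + 1)) ∧
      ∏ i ∈ Finset.range (2 * m + 2), (1 - (-x) ^ (i + 1)) ≤ 3 / 2) := by
  induction m with
  | zero =>
    simp only [Finset.prod_range_succ, Finset.prod_range_zero, mul_zero, zero_add]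
    refine ⟨⟨by linarith, by linarith⟩, ?_, ?_⟩
    · have h : 0 < 1 - x - x * x := by nlinarith
      have h2 := mul_pos h0 h
      have h3 : 1 * (1 - (-x) ^ 1) * (1 - (-x) ^ (1 + 1)) = 1 + x * (1 - x - x * x) := by ring
      rw [h3]; linarith
    · nlinarith [mul_pos h0 h0, mul_pos (mul_pos h0 h0) h0]
  | succ m ih =>
    obtain ⟨⟨a1, a2⟩, b1, b2⟩ := ih
    have e3 : 2 * (m + 1) + 1 = (2 * m + 2) + 1 := by ring
    have e4 : 2 * (m + 1) + 2 = (2 * m + 2) + 1 + 1 := by ring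
    have p2 : (-x) ^ (2 * m + 1 + 1) = x ^ (2 * m + 2) :=
      Even.neg_pow ⟨m + 1, by ring⟩ x
    have p3 : (-x) ^ (2 * m + 2 + 1) = -(x * x ^ (2 * m + 2)) := by
      rw [pow_succ, show 2 * m + 2 = 2 * m + 1 + 1 from rfl, p2]; ring
    have p4 : (-x) ^ (2 * m + 2 + 1 + 1) = x * (x * x ^ (2 * m + 2)) := by
      rw [pow_succ, p3]; ring
    have hB : ∏ i ∈ Finset.range (2 * m + 2), (1 - (-x) ^ (i + 1)) =
        (∏ i ∈ Finset.range (2 * m + 1), (1 - (-x) ^ (i + 1))) * (1 - x ^ (2 * m + 2)) := by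
      rw [Finset.prod_range_succ _ (2 * m + 1), p2]
    rw [e3, e4, Finset.prod_range_succ _ (2 * m + 2 + 1),
      Finset.prod_range_succ _ (2 * m + 2), p3, p4]
    have y0 : 0 < x ^ (2 * m + 2) := by positivity
    have y1 : x ^ (2 * m + 2) ≤ 1 := pow_le_one₀ h0.le (by linarith)
    generalize x ^ (2 * m + 2) = y at *
    generalize ∏ i ∈ Finset.range (2 * m + 2), (1 - (-x) ^ (i + 1)) = B at *
    generalize ∏ i ∈ Finset.range (2 * m + 1), (1 - (-x) ^ (i + 1)) = A at *
    have xy : 0 < x * y := mul_pos h0 y0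
    have xxy : 0 < x * (x * y) := mul_pos h0 xy
    have c1 : 1 < B * (1 - -(x * y)) := by nlinarith
    have c2 : B * (1 - -(x * y)) ≤ 3 / 2 := by
      have : (1 - y) * (1 - -(x * y)) ≤ 1 := by nlinarith [mul_pos xy y0]
      rw [hB, mul_assoc]
      nlinarith
    have c3 : 1 ≤ (1 - -(x * y)) * (1 - x * (x * y)) := by
      have h : 0 ≤ 1 - x - x * (x * y) := by nlinarith
      nlinarith [mul_nonneg xy.le h]
    refine ⟨⟨c1, c2⟩, ?_, ?_⟩
    · rw [mul_assoc]; nlinarith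
    · nlinarith

theorem stmt17 (q : ℝ) (hq : 2 ≤ q) (n : ℕ) (hn : 1 ≤ n) :
    1 < ∏ i ∈ Finset.range n, (1 - (-1 / q) ^ (i + 1)) ∧
      ∏ i ∈ Finset.range n, (1 - (-1 / q) ^ (i + 1)) ≤ 3 / 2 := by
  have h0 : 0 < 1 / q := by positivity
  have h1 : 1 / q ≤ 1 / 2 := one_div_le_one_div_of_le (by norm_num) hq
  rw [neg_div]
  obtain ⟨k, rfl⟩ := Nat.exists_eq_add_of_le' hn
  rcases Nat.even_or_odd' k with ⟨m, rfl | rfl⟩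
  · exact (stmt17_aux _ h0 h1 m).1
  · exact (stmt17_aux _ h0 h1 m).2
end
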